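/- Let P be a set of n points in ℝ^d and let ε ∈ (0,1) be a parameter with n ≥ 27/ε⁴. Then there exists a partition of P into k pairwise disjoint nonempty sets P_1, …, P_k such that: (i) |P_i| ≤ 4/ε² + 9/2 for every i; (ii) for every i, the convex hull of P_i intersects the closed ball of radius ε·avgp(P) centered at c(P); and (iii) k ≥ n/(4/ε² + 9/2). -/

import Mathlib

open Finset

/-- The centroid of a finite set of points in `ℝ^d`. -/
noncomputable def centroid {d : ℕ} (P : Finset (EuclideanSpace ℝ (Fin d))) :
    EuclideanSpace ℝ (Fin d) :=
  (P.card : ℝ)⁻¹ • ∑ p ∈ P, p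

/-- The average 1-mean price of a finite set of points in `ℝ^d`. -/
noncomputable def avgp {d : ℕ} (P : Finset (EuclideanSpace ℝ (Fin d))) : ℝ :=
  Real.sqrt ((P.card : ℝ)⁻¹ * ∑ p ∈ P, ‖p - centroid P‖ ^ 2)

theorem card_mul_sum_perm_norm_sq {V ι : Type*} [NormedAddCommGroup V] [Fintype ι]
    [DecidableEq ι] (x : ι → V) (a : ι) :
    (Fintype.card ι : ℝ) * ∑ σ : Equiv.Perm ι, ‖x (σ a)‖ ^ 2 =
      (Fintype.card (Equiv.Perm ι) : ℝ) * ∑ i, ‖x i‖ ^ 2 := by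
  have hswap : ∀ c ∈ (univ : Finset ι), ∑ σ : Equiv.Perm ι, ‖x (σ c)‖ ^ 2 =
      ∑ σ : Equiv.Perm ι, ‖x (σ a)‖ ^ 2 := by
    intro c _
    rw [← Equiv.sum_comp (Equiv.mulRight (Equiv.swap a c))]
    simp
  have hsum := Finset.sum_congr rfl hswap
  rw [Finset.sum_comm, Finset.sum_const, nsmul_eq_mul] at hsum
  rw [← Finset.card_univ, ← hsum,
    Finset.sum_congr rfl fun σ _ => Equiv.sum_comp σ fun i => ‖x i‖ ^ 2, Finset.sum_const,
    nsmul_eq_mul, Finset.card_univ]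

section Averaging

variable {V ι : Type*} [NormedAddCommGroup V] [InnerProductSpace ℝ V] [Fintype ι] [DecidableEq ι]

/-- The values of a centred family at two distinct uniformly permuted indices are
nonpositively correlated. -/
theorem sum_perm_inner_nonpos (x : ι → V) (hx : ∑ i, x i = 0) {a b : ι} (hab : a ≠ b) :
    ∑ σ : Equiv.Perm ι, inner ℝ (x (σ a)) (x (σ b)) ≤ 0 := by
  have hswap : ∀ c ∈ univ.erase a, ∑ σ : Equiv.Perm ι, inner ℝ (x (σ a)) (x (σ c)) =
      ∑ σ : Equiv.Perm ι, inner ℝ (x (σ a)) (x (σ b)) := by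
    intro c hc
    have hca : c ≠ a := (Finset.mem_erase.1 hc).1
    rw [← Equiv.sum_comp (Equiv.mulRight (Equiv.swap b c))]
    refine Finset.sum_congr rfl fun σ _ => ?_
    simp [Equiv.swap_apply_of_ne_of_ne hab hca.symm]
  have hsum : ∑ c ∈ univ.erase a, ∑ σ : Equiv.Perm ι, inner ℝ (x (σ a)) (x (σ c)) ≤ 0 := by
    rw [Finset.sum_comm]
    refine Finset.sum_nonpos fun σ _ => ?_
    have h : ∑ c ∈ univ.erase a, x (σ c) = -x (σ a) := by
      rw [Finset.sum_erase_eq_sub (Finset.mem_univ a), Equiv.sum_comp σ x, hx, zero_sub]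
    rw [← inner_sum, h, inner_neg_right, real_inner_self_eq_norm_sq]
    exact neg_nonpos.2 (sq_nonneg _)
  rw [Finset.sum_congr rfl hswap, Finset.sum_const, nsmul_eq_mul] at hsum
  have hpos : (0 : ℝ) < ((univ.erase a).card : ℝ) :=
    Nat.cast_pos.2 (Finset.card_pos.2 ⟨b, Finset.mem_erase.2 ⟨hab.symm, Finset.mem_univ b⟩⟩)
  exact nonpos_of_mul_nonpos_right hsum hpos

/-- Expected squared norm of the sum of a uniformly permuted block of a centred family. -/
theorem card_mul_sum_perm_norm_sum_sq_le {m : ℕ} (x : ι → V) (hx : ∑ i, x i = 0)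
    (e : Fin m → ι) (he : Function.Injective e) :
    (Fintype.card ι : ℝ) * ∑ σ : Equiv.Perm ι, ‖∑ i, x (σ (e i))‖ ^ 2 ≤
      (Fintype.card (Equiv.Perm ι) : ℝ) * (m * ∑ i, ‖x i‖ ^ 2) := by
  have hexp : ∑ σ : Equiv.Perm ι, ‖∑ i, x (σ (e i))‖ ^ 2 =
      ∑ i, ∑ j, ∑ σ : Equiv.Perm ι, inner ℝ (x (σ (e i))) (x (σ (e j))) := by
    simp_rw [← real_inner_self_eq_norm_sq, sum_inner, inner_sum]
    rw [Finset.sum_comm]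
    exact Finset.sum_congr rfl fun i _ => Finset.sum_comm
  have hle : ∀ i, ∑ j, ∑ σ : Equiv.Perm ι, inner ℝ (x (σ (e i))) (x (σ (e j))) ≤
      ∑ σ : Equiv.Perm ι, ‖x (σ (e i))‖ ^ 2 := by
    intro i
    rw [← Finset.add_sum_erase _ _ (Finset.mem_univ i)]
    have h : ∑ j ∈ univ.erase i, ∑ σ : Equiv.Perm ι,
        inner ℝ (x (σ (e i))) (x (σ (e j))) ≤ 0 :=
      Finset.sum_nonpos fun j hj =>
        sum_perm_inner_nonpos x hx (he.ne (Finset.mem_erase.1 hj).1.symm)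
    simp_rw [real_inner_self_eq_norm_sq]
    linarith
  calc (Fintype.card ι : ℝ) * ∑ σ : Equiv.Perm ι, ‖∑ i, x (σ (e i))‖ ^ 2
      ≤ (Fintype.card ι : ℝ) * ∑ i, ∑ σ : Equiv.Perm ι, ‖x (σ (e i))‖ ^ 2 := by
        rw [hexp]
        gcongr with i
        exact hle i
    _ = (Fintype.card (Equiv.Perm ι) : ℝ) * (m * ∑ i, ‖x i‖ ^ 2) := by
        simp_rw [Finset.mul_sum (univ : Finset (Fin m)), card_mul_sum_perm_norm_sq]
        simp only [Finset.sum_const, Finset.card_univ, Fintype.card_fin, nsmul_eq_mul]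
        ring

/-- Some permutation makes the block sums of a centred family small on average. -/
theorem exists_perm_card_mul_sum_norm_sum_sq_le {k m : ℕ} (x : ι → V) (hx : ∑ i, x i = 0)
    (e : Fin k × Fin m ↪ ι) :
    ∃ σ : Equiv.Perm ι, (Fintype.card ι : ℝ) * ∑ j, ‖∑ i, x (σ (e (j, i)))‖ ^ 2 ≤
      k * (m * ∑ i, ‖x i‖ ^ 2) := by
  have h : ∑ σ : Equiv.Perm ι, (Fintype.card ι : ℝ) * ∑ j, ‖∑ i, x (σ (e (j, i)))‖ ^ 2 ≤
      ∑ _σ : Equiv.Perm ι, (k : ℝ) * (m * ∑ i, ‖x i‖ ^ 2) := by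
    rw [← Finset.mul_sum, Finset.sum_comm, Finset.mul_sum]
    calc ∑ j, (Fintype.card ι : ℝ) * ∑ σ : Equiv.Perm ι, ‖∑ i, x (σ (e (j, i)))‖ ^ 2
        ≤ ∑ _j : Fin k, (Fintype.card (Equiv.Perm ι) : ℝ) * (m * ∑ i, ‖x i‖ ^ 2) :=
          Finset.sum_le_sum fun j _ =>
            card_mul_sum_perm_norm_sum_sq_le x hx (fun i => e (j, i)) fun i i' hi => by
              simpa using e.injective hi
      _ = _ := by
        simp only [Finset.sum_const, Finset.card_univ, Fintype.card_fin, nsmul_eq_mul]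
        ring
  obtain ⟨σ, -, hσ⟩ := Finset.exists_le_of_sum_le Finset.univ_nonempty h
  exact ⟨σ, hσ⟩

end Averaging

/-- A colouring of `S` with colour classes of size at most `L` extends to any larger set
of size at most `L` times the number of colours. -/
theorem exists_coloring_extension {α κ : Type*} [DecidableEq α] [Fintype κ] [DecidableEq κ]
    {L : ℕ} (S : Finset α) (f₀ : α → κ) (hf₀ : ∀ j, #{p ∈ S | f₀ p = j} ≤ L)
    (P : Finset α) (hSP : S ⊆ P) (hP : #P ≤ Fintype.card κ * L) :
    ∃ f : α → κ, (∀ p ∈ S, f p = f₀ p) ∧ ∀ j, #{p ∈ P | f p = j} ≤ L := by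
  suffices H : ∀ T : Finset α, #(S ∪ T) ≤ Fintype.card κ * L →
      ∃ f : α → κ, (∀ p ∈ S, f p = f₀ p) ∧ ∀ j, #{p ∈ S ∪ T | f p = j} ≤ L by
    simpa [Finset.union_eq_right.2 hSP, hP] using H P
  intro T
  induction T using Finset.induction_on with
  | empty => exact fun _ => ⟨f₀, fun _ _ => rfl, by simpa using hf₀⟩
  | insert p T _ ih =>
    intro hcard
    rw [Finset.union_insert] at hcard ⊢
    obtain ⟨f, hfS, hf⟩ := ih ((Finset.card_le_card (Finset.subset_insert _ _)).trans hcard)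
    by_cases hp : p ∈ S ∪ T
    · exact ⟨f, hfS, by simpa [Finset.insert_eq_of_mem hp] using hf⟩
    rw [Finset.card_insert_of_notMem hp] at hcard
    obtain ⟨j₀, -, hj₀⟩ := Finset.exists_card_fiber_lt_of_card_lt_mul
      (s := S ∪ T) (t := univ) (f := f) (n := L) (by rw [Finset.card_univ]; omega)
    have hagree : ∀ q ∈ S ∪ T, Function.update f p j₀ q = f q := fun q hq =>
      Function.update_of_ne (by rintro rfl; exact hp hq) _ _
    refine ⟨Function.update f p j₀, fun q hq => ?_, fun j => ?_⟩
    · rw [hagree q (Finset.mem_union_left _ hq), hfS q hq]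
    · have hfib : {q ∈ S ∪ T | Function.update f p j₀ q = j} = {q ∈ S ∪ T | f q = j} :=
        Finset.filter_congr fun q hq => by rw [hagree q hq]
      rw [Finset.filter_insert, hfib, Function.update_self]
      split_ifs with h
      · subst h
        exact (Finset.card_insert_le _ _).trans hj₀
      · exact hf j

theorem card_mul_avgp_sq {d : ℕ} (P : Finset (EuclideanSpace ℝ (Fin d))) :
    (#P : ℝ) * avgp P ^ 2 = ∑ p ∈ P, ‖p - centroid P‖ ^ 2 := by
  rcases P.eq_empty_or_nonempty with rfl | hP
  · simp
  have h : (#P : ℝ) ≠ 0 := Nat.cast_ne_zero.2 hP.card_ne_zero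
  rw [avgp, Real.sq_sqrt (by positivity), mul_inv_cancel_left₀ h]

theorem sum_sub_centroid {d : ℕ} {P : Finset (EuclideanSpace ℝ (Fin d))} (hP : P.Nonempty) :
    ∑ p ∈ P, (p - centroid P) = 0 := by
  have h : (#P : ℝ) ≠ 0 := Nat.cast_ne_zero.2 hP.card_ne_zero
  rw [Finset.sum_sub_distrib, Finset.sum_const, ← Nat.cast_smul_eq_nsmul ℝ, _root_.centroid,
    smul_inv_smul₀ h, sub_self]

/-- Among `k` disjoint `m`-element blocks of a suitable arrangement of `P`, at least half
have a centroid within `ε * avgp P` of the centroid of `P`, provided `2 ≤ m * ε ^ 2`. -/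
theorem exists_blocks_near_centroid {d k m : ℕ} {P : Finset (EuclideanSpace ℝ (Fin d))}
    (hP : P.Nonempty) (hkm : k * m ≤ #P) {ε : ℝ} (hε : 0 < ε) (hm : 2 ≤ (m : ℝ) * ε ^ 2) :
    ∃ (g : Fin k × Fin m → EuclideanSpace ℝ (Fin d)) (G : Finset (Fin k)),
      Function.Injective g ∧ (∀ z, g z ∈ P) ∧ k ≤ 2 * #G ∧
      ∀ j ∈ G, ‖∑ i, (g (j, i) - centroid P)‖ ≤ m * (ε * avgp P) := by
  obtain ⟨e⟩ : Nonempty (Fin k × Fin m ↪ P) :=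
    Function.Embedding.nonempty_of_card_le (by simpa using hkm)
  let x : P → EuclideanSpace ℝ (Fin d) := fun p => p - centroid P
  have hx : ∑ p, x p = 0 := by
    rw [← sum_sub_centroid hP, ← Finset.sum_coe_sort P fun p => p - centroid P]
  have hx2 : ∑ p, ‖x p‖ ^ 2 = #P * avgp P ^ 2 := by
    rw [card_mul_avgp_sq, ← Finset.sum_coe_sort P fun p => ‖p - centroid P‖ ^ 2]
  obtain ⟨σ, hσ⟩ := exists_perm_card_mul_sum_norm_sum_sq_le x hx e
  have hcard : (0 : ℝ) < #P := Nat.cast_pos.2 hP.card_pos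
  have hsum : ∑ j, ‖∑ i, x (σ (e (j, i)))‖ ^ 2 ≤ k * m * avgp P ^ 2 := by
    rw [hx2, Fintype.card_coe] at hσ
    refine le_of_mul_le_mul_left (hσ.trans_eq ?_) hcard
    ring
  let r : ℝ := m * (ε * avgp P)
  have hr : 0 ≤ r := mul_nonneg m.cast_nonneg (mul_nonneg hε.le (Real.sqrt_nonneg _))
  let B : Finset (Fin k) := {j | ¬ ‖∑ i, x (σ (e (j, i)))‖ ≤ r}
  have hB : 2 * #B ≤ k := by
    rcases B.eq_empty_or_nonempty with hB | hB
    · simp [hB]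
    have hlt : #B * r ^ 2 < k * m * avgp P ^ 2 := by
      calc (#B : ℝ) * r ^ 2 = ∑ _j ∈ B, r ^ 2 := by simp
        _ < ∑ j ∈ B, ‖∑ i, x (σ (e (j, i)))‖ ^ 2 :=
          Finset.sum_lt_sum_of_nonempty hB fun j hj =>
            pow_lt_pow_left₀ (not_le.1 (Finset.mem_filter.1 hj).2) hr two_ne_zero
        _ ≤ ∑ j, ‖∑ i, x (σ (e (j, i)))‖ ^ 2 :=
          Finset.sum_le_sum_of_subset_of_nonneg (Finset.subset_univ _) fun _ _ _ => sq_nonneg _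
        _ ≤ _ := hsum
    have hle : (2 * #B : ℝ) * (m * avgp P ^ 2) ≤ #B * r ^ 2 := by
      have h := mul_le_mul_of_nonneg_right hm
        (by positivity : (0 : ℝ) ≤ #B * (m * avgp P ^ 2))
      simp only [r]
      linarith
    have h : (2 * #B : ℝ) < k :=
      lt_of_mul_lt_mul_right (by linarith : (2 * #B : ℝ) * (m * avgp P ^ 2) <
        k * (m * avgp P ^ 2)) (by positivity)
    exact_mod_cast h.le
  refine ⟨fun z => σ (e z), univ.filter fun j => ‖∑ i, x (σ (e (j, i)))‖ ≤ r, ?_, fun z => (σ (e z)).2, ?_,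
    fun j hj => (Finset.mem_filter.1 hj).2⟩
  · exact Subtype.val_injective.comp (σ.injective.comp e.injective)
  · have h := Finset.card_filter_add_card_filter_not (s := (univ : Finset (Fin k)))
      fun j => ‖∑ i, x (σ (e (j, i)))‖ ≤ r
    rw [Finset.card_univ, Fintype.card_fin] at h
    change _ + #B = k at h
    omega

theorem convexHull_inter_closedBall_nonempty {V : Type*} [NormedAddCommGroup V]
    [NormedSpace ℝ V] {m : ℕ} (hm : 0 < m) {s : Set V} (y : Fin m → V) (hy : ∀ i, y i ∈ s)
    {c : V} {r : ℝ} (h : ‖∑ i, (y i - c)‖ ≤ m * r) :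
    (convexHull ℝ s ∩ Metric.closedBall c r).Nonempty := by
  have hm' : (0 : ℝ) < m := Nat.cast_pos.2 hm
  refine ⟨∑ i, (m : ℝ)⁻¹ • y i, ?_, ?_⟩
  · refine (convex_convexHull ℝ s).sum_mem (fun _ _ => by positivity) ?_
      fun i _ => subset_convexHull ℝ s (hy i)
    simp [hm'.ne']
  · have heq : ∑ i, (m : ℝ)⁻¹ • y i - c = (m : ℝ)⁻¹ • ∑ i, (y i - c) := by
      rw [Finset.sum_sub_distrib, smul_sub, Finset.smul_sum, Finset.sum_const, Finset.card_univ,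
        Fintype.card_fin, ← Nat.cast_smul_eq_nsmul ℝ, inv_smul_smul₀ hm'.ne']
    rw [mem_closedBall_iff_norm, heq, norm_smul, Real.norm_of_nonneg (by positivity),
      inv_mul_le_iff₀ hm']
    exact h


/-- No-dimensional Tverberg partition lemma (radius measured via `avgp`): if
`n ≥ 27/ε⁴`, then `P` can be partitioned into `k ≥ n/(4/ε² + 9/2)` nonempty sets,
each of size at most `4/ε² + 9/2`, whose convex hulls all intersect the closed ball
of radius `ε · avgp(P)` centered at `c(P)`. -/
theorem tverberg_partition_avgp {d : ℕ} (P : Finset (EuclideanSpace ℝ (Fin d)))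
    (n : ℕ) (ε : ℝ) (hn : P.card = n) (hε : ε ∈ Set.Ioo (0 : ℝ) 1)
    (hbig : (27 : ℝ) / ε ^ 4 ≤ (n : ℝ)) :
    ∃ (k : ℕ) (Q : Fin k → Finset (EuclideanSpace ℝ (Fin d))),
      (∀ i, (Q i).Nonempty) ∧
      (∀ i j, i ≠ j → Disjoint (Q i) (Q j)) ∧
      (⋃ i, (Q i : Set (EuclideanSpace ℝ (Fin d)))) = (P : Set (EuclideanSpace ℝ (Fin d))) ∧
      (∀ i, ((Q i).card : ℝ) ≤ 4 / ε ^ 2 + 9 / 2) ∧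
      (∀ i, (convexHull ℝ (Q i : Set (EuclideanSpace ℝ (Fin d))) ∩
          Metric.closedBall (centroid P) (ε * avgp P)).Nonempty) ∧
      (n : ℝ) / (4 / ε ^ 2 + 9 / 2) ≤ (k : ℝ) := by
  obtain ⟨hε0, hε1⟩ := hε
  obtain ⟨m, hm_le, hm_lt, hm0⟩ : ∃ m : ℕ, 2 / ε ^ 2 ≤ m ∧ (m : ℝ) < 2 / ε ^ 2 + 1 ∧ 0 < m :=
    ⟨⌈2 / ε ^ 2⌉₊, Nat.le_ceil _, Nat.ceil_lt_add_one (by positivity),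
      Nat.ceil_pos.2 (by positivity)⟩
  have hmε : 2 ≤ (m : ℝ) * ε ^ 2 := (div_le_iff₀ (by positivity)).1 hm_le
  have hmn : m ^ 2 ≤ n := by
    have ht : 1 ≤ 1 / ε ^ 2 := (one_le_div (by positivity)).2 (pow_le_one₀ hε0.le hε1.le)
    have h2 : 2 / ε ^ 2 = 2 * (1 / ε ^ 2) := by ring
    have h27 : 27 / ε ^ 4 = 27 * (1 / ε ^ 2) ^ 2 := by ring
    rw [h2] at hm_lt
    rw [h27] at hbig
    have h : (m : ℝ) ^ 2 ≤ n := by nlinarith [(m.cast_nonneg : (0 : ℝ) ≤ m)]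
    exact_mod_cast h
  have hn0 : 0 < n := (pow_pos hm0 2).trans_le hmn
  have hP : P.Nonempty := Finset.card_pos.1 (hn ▸ hn0)
  have hL : ((2 * m + 2 : ℕ) : ℝ) ≤ 4 / ε ^ 2 + 9 / 2 := by
    have h4 : 4 / ε ^ 2 = 2 * (2 / ε ^ 2) := by ring
    push_cast
    linarith
  obtain ⟨g, G, hg, hgP, hG, hnear⟩ := exists_blocks_near_centroid (k := n / m) (m := m) hP
    (hn ▸ Nat.div_mul_le_self n m) hε0 hmε
  have hcap : n ≤ #G * (2 * m + 2) := by
    have hdiv : n < m * (n / m) + m := by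
      have h1 := Nat.div_add_mod n m
      have h2 := Nat.mod_lt n hm0
      omega
    have hq : m ≤ n / m := (Nat.le_div_iff_mul_le hm0).2 (by rwa [← sq])
    nlinarith
  have hG0 : 0 < #G := Nat.pos_of_mul_pos_right (hn0.trans_le hcap)
  have : Nonempty G := (Finset.card_pos.1 hG0).to_subtype
  let g' : G × Fin m → EuclideanSpace ℝ (Fin d) := fun z => g (z.1, z.2)
  have hg' : Function.Injective g' := fun z w h => by
    have := hg h
    simp only [Prod.mk.injEq] at this
    exact Prod.ext (Subtype.ext this.1) this.2
  let f₀ : EuclideanSpace ℝ (Fin d) → G :=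
    Function.extend g' Prod.fst fun _ => Classical.arbitrary G
  have hf₀ : ∀ z, f₀ (g' z) = z.1 := fun z => hg'.extend_apply _ _ z
  classical
  obtain ⟨f, hf, hfL⟩ := exists_coloring_extension (L := 2 * m + 2) (univ.image g') f₀
    (fun j => by
      have hsub : {p ∈ univ.image g' | f₀ p = j} ⊆ univ.image fun i => g' (j, i) := by
        intro p hp
        simp only [Finset.mem_filter, Finset.mem_image, Finset.mem_univ, true_and] at hp ⊢
        obtain ⟨⟨z, rfl⟩, hz⟩ := hp
        rw [hf₀] at hz
        exact ⟨z.2, by rw [← hz]⟩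
      calc _ ≤ #(univ.image fun i => g' (j, i)) := Finset.card_le_card hsub
        _ ≤ m := by simpa using Finset.card_image_le (s := univ) (f := fun i => g' (j, i))
        _ ≤ 2 * m + 2 := by omega)
    P (Finset.image_subset_iff.2 fun z _ => hgP _) (by rwa [Fintype.card_coe, hn])
  have hgf : ∀ j i, f (g' (j, i)) = j := fun j i => by
    rw [hf _ (Finset.mem_image_of_mem _ (Finset.mem_univ _)), hf₀]
  obtain ⟨t⟩ : Nonempty (Fin #G ≃ G) := ⟨G.equivFin.symm⟩
  have hmem : ∀ a i, g' (t a, i) ∈ P.filter fun p => f p = t a := fun a i =>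
    Finset.mem_filter.2 ⟨hgP _, hgf _ _⟩
  refine ⟨#G, fun a => P.filter fun p => f p = t a, fun a => ⟨_, hmem a ⟨0, hm0⟩⟩, fun a b hab => ?_, ?_,
    fun a => (Nat.cast_le.2 (hfL _)).trans hL, fun a => ?_, ?_⟩
  · exact Finset.disjoint_filter.2 fun p _ ha hb => hab (t.injective (ha.symm.trans hb))
  · ext p
    simp only [Set.mem_iUnion, Finset.mem_coe, Finset.mem_filter]
    exact ⟨fun ⟨_, h, _⟩ => h, fun h => ⟨t.symm (f p), h, (t.apply_symm_apply _).symm⟩⟩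
  · exact convexHull_inter_closedBall_nonempty hm0 (fun i => g' (t a, i))
      (fun i => Finset.mem_coe.2 (hmem a i)) (hnear (t a) (t a).2)
  · rw [div_le_iff₀ (by positivity)]
    calc (n : ℝ) ≤ #G * ((2 * m + 2 : ℕ) : ℝ) := by exact_mod_cast hcap
      _ ≤ _ := by gcongr
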